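/- arXiv:2402.01302 — 2 statements merged into one kernel-verified Lean document; each statement's English description precedes it below -/
import Mathlib

section
/- Fix y ∈ ℝ^d. The logistic loss F(x) = log(1 + exp(‖x − y‖²)) is (i) coercive: F(x) → ∞ as ‖x‖ → ∞; (ii) convex on ℝ^d; and (iii) β-smooth with β = 2 + 4e^{−1}: its Hessian satisfies ∇²F(x) = (2/(1 + exp(−‖x−y‖²))) I + (4exp(−‖x−y‖²)/(1 + exp(−‖x−y‖²))²)(x−y)(x−y)^⊤ and ‖∇²F(x)‖ ≤ 2 + 4e^{−1} for all x; consequently ∇F is Lipschitz with constant 2 + 4e^{−1}. -/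
noncomputable section

open scoped RealInnerProductSpace
open Filter


lemma aux_scalar (s t : ℝ) :
    (1 / (1 + Real.exp (-t))) * (s - t) ≤
      Real.log (1 + Real.exp s) - Real.log (1 + Real.exp t) := by
  have hs : 0 < 1 + Real.exp s := by positivity
  have ht : 0 < 1 + Real.exp t := by positivity
  have ht2 : 0 < 1 + Real.exp (-t) := by positivity
  have hm : Real.exp t * Real.exp (-t) = 1 := by rw [← Real.exp_add]; simp
  have hp : 1 / (1 + Real.exp (-t)) = Real.exp t / (1 + Real.exp t) := by
    rw [div_eq_div_iff ht2.ne' ht.ne']; linarith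
  rw [← Real.log_div hs.ne' ht.ne', Real.le_log_iff_exp_le (by positivity), hp]
  have hc := convexOn_exp.2 (Set.mem_univ (s - t)) (Set.mem_univ 0)
    (show 0 ≤ Real.exp t / (1 + Real.exp t) by positivity)
    (show 0 ≤ 1 / (1 + Real.exp t) by positivity) (by field_simp; ring)
  simp only [smul_eq_mul, mul_zero, add_zero, Real.exp_zero, mul_one] at hc
  refine hc.trans (le_of_eq ?_)
  rw [Real.exp_sub]
  field_simp
  ring

lemma aux_texp (t : ℝ) : t * Real.exp (-t) ≤ Real.exp (-1) := by
  have h := Real.add_one_le_exp (t - 1)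
  have : Real.exp (-1) = Real.exp (t - 1) * Real.exp (-t) := by
    rw [← Real.exp_add]; congr 1; ring
  rw [this]
  exact mul_le_mul_of_nonneg_right (by linarith) (Real.exp_pos _).le

/-- for fixed `y ∈ ℝ^d`, the logistic loss
`F(x) = log(1 + exp(‖x − y‖²))` is (i) coercive, (ii) convex, and (iii) `β`-smooth with
`β = 2 + 4e⁻¹`: its gradient is `G(x) = (2/(1 + exp(−‖x−y‖²)))(x − y)`, its Hessian is
`H(x) = (2/(1 + exp(−‖x−y‖²))) I + (4exp(−‖x−y‖²)/(1 + exp(−‖x−y‖²))²)(x−y)(x−y)ᵀ`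
with `‖H(x)‖ ≤ 2 + 4e⁻¹`; consequently `G` is Lipschitz with constant `2 + 4e⁻¹`. -/
theorem logistic_loss_properties {d : ℕ} (y : EuclideanSpace ℝ (Fin d)) :
    let F : EuclideanSpace ℝ (Fin d) → ℝ :=
      fun z => Real.log (1 + Real.exp (‖z - y‖ ^ 2))
    let G : EuclideanSpace ℝ (Fin d) → EuclideanSpace ℝ (Fin d) :=
      fun z => (2 / (1 + Real.exp (-‖z - y‖ ^ 2))) • (z - y)
    let H : EuclideanSpace ℝ (Fin d) →
        (EuclideanSpace ℝ (Fin d) →L[ℝ] EuclideanSpace ℝ (Fin d)) :=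
      fun x => (2 / (1 + Real.exp (-‖x - y‖ ^ 2))) •
          ContinuousLinearMap.id ℝ (EuclideanSpace ℝ (Fin d)) +
        (4 * Real.exp (-‖x - y‖ ^ 2) / (1 + Real.exp (-‖x - y‖ ^ 2)) ^ 2) •
          ((innerSL ℝ (x - y)).smulRight (x - y))
    Tendsto F (cocompact (EuclideanSpace ℝ (Fin d))) atTop ∧
    ConvexOn ℝ Set.univ F ∧
    (∀ x, HasGradientAt F (G x) x) ∧
    (∀ x, HasFDerivAt G (H x) x ∧ ‖H x‖ ≤ 2 + 4 * Real.exp (-1)) ∧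
    (∀ x z : EuclideanSpace ℝ (Fin d),
      0 ≤ F x - F z - ⟪G z, x - z⟫ ∧
        F x - F z - ⟪G z, x - z⟫ ≤ (2 + 4 * Real.exp (-1)) / 2 * ‖x - z‖ ^ 2) ∧
    LipschitzWith (2 + 4 * Real.exp (-1)).toNNReal G := by
  intro F G H
  set β : ℝ := 2 + 4 * Real.exp (-1) with hβ
  have hβ0 : 0 ≤ β := by positivity
  have hsq : ∀ x : EuclideanSpace ℝ (Fin d),
      HasFDerivAt (fun z => ‖z - y‖ ^ 2) ((2 : ℝ) • innerSL ℝ (x - y)) x := by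
    intro x
    have h := ((hasFDerivAt_id x).sub_const y).norm_sq
    refine h.congr_fderiv ?_
    ext v; simp
  have hgrad : ∀ x, HasGradientAt F (G x) x := by
    intro x
    rw [hasGradientAt_iff_hasFDerivAt]
    have h := (((hsq x).exp).const_add 1).log (by positivity)
    refine h.congr_fderiv ?_
    ext v
    simp only [G, smul_apply, innerSL_apply_apply,
      InnerProductSpace.toDual_apply_apply, smul_eq_mul, real_inner_smul_left]
    rw [Real.exp_neg]
    field_simp
    ring
  have hhess : ∀ x, HasFDerivAt G (H x) x := by
    intro x
    have h1 := ((((hsq x).neg).exp).const_add 1)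
    have h2 := (((hasDerivAt_inv (x := 1 + Real.exp (-‖x - y‖ ^ 2)) (by positivity)).comp_hasFDerivAt x h1).const_mul 2).smul
      ((hasFDerivAt_id x).sub_const y)
    refine (h2.congr_fderiv ?_)
    ext1 v
    simp [H, smul_smul, div_eq_mul_inv]
    congr 1
    ring
  have hbound : ∀ x, ‖H x‖ ≤ β := by
    intro x
    have he := Real.exp_pos (-‖x - y‖ ^ 2)
    refine (norm_add_le _ _).trans (add_le_add ?_ ?_)
    · rw [norm_smul, Real.norm_of_nonneg (by positivity)]
      calc _ ≤ 2 / (1 + Real.exp (-‖x - y‖ ^ 2)) * 1 :=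
            mul_le_mul_of_nonneg_left ContinuousLinearMap.norm_id_le (by positivity)
        _ ≤ 2 := by
          rw [mul_one, div_le_iff₀ (by positivity)]; linarith
    · rw [norm_smul, Real.norm_of_nonneg (by positivity), ContinuousLinearMap.norm_smulRight_apply,
        innerSL_apply_norm]
      have ht := aux_texp (‖x - y‖ ^ 2)
      calc _ ≤ 4 * Real.exp (-‖x - y‖ ^ 2) * (‖x - y‖ * ‖x - y‖) := by
            refine mul_le_mul_of_nonneg_right ?_ (by positivity)
            refine div_le_self (by positivity) ?_
            nlinarith
        _ ≤ _ := by nlinarith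
  have hlip : LipschitzWith β.toNNReal G := by
    refine lipschitzWith_of_nnnorm_fderiv_le (𝕜 := ℝ) (fun x => (hhess x).differentiableAt) ?_
    intro x
    rw [(hhess x).fderiv]
    rw [← NNReal.coe_le_coe, Real.coe_toNNReal _ hβ0]
    exact hbound x
  have hlow : ∀ x z, 0 ≤ F x - F z - ⟪G z, x - z⟫ := by
    intro x z
    have h := aux_scalar (‖x - y‖ ^ 2) (‖z - y‖ ^ 2)
    have h2 : ‖x - y‖ ^ 2 = ‖z - y‖ ^ 2 + 2 * ⟪z - y, x - z⟫ + ‖x - z‖ ^ 2 := by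
      rw [← norm_add_sq_real]; congr 2; abel
    have h3 : (1 / (1 + Real.exp (-‖z - y‖ ^ 2))) * (2 * ⟪z - y, x - z⟫) ≤
        (1 / (1 + Real.exp (-‖z - y‖ ^ 2))) * (‖x - y‖ ^ 2 - ‖z - y‖ ^ 2) := by
      refine mul_le_mul_of_nonneg_left ?_ (by positivity)
      nlinarith [sq_nonneg ‖x - z‖]
    have h4 : ⟪G z, x - z⟫ = (1 / (1 + Real.exp (-‖z - y‖ ^ 2))) * (2 * ⟪z - y, x - z⟫) := by
      simp only [G, real_inner_smul_left]; ring
    rw [h4]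
    simp only [F]
    linarith
  have hup : ∀ x z, F x - F z - ⟪G z, x - z⟫ ≤ β / 2 * ‖x - z‖ ^ 2 := by
    intro x z
    let g : ℝ → ℝ := fun s => F (z + s • (x - z)) - s * ⟪G z, x - z⟫ - β / 2 * ‖x - z‖ ^ 2 * s ^ 2
    have hg : ∀ s, HasDerivAt g (⟪G (z + s • (x - z)), x - z⟫ - ⟪G z, x - z⟫
        - β / 2 * ‖x - z‖ ^ 2 * (2 * s)) s := by
      intro s
      have hl : HasDerivAt (fun s : ℝ => z + s • (x - z)) (x - z) s := by
        simpa using ((hasDerivAt_id s).smul_const (x - z)).const_add z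
      have h1 := (hgrad (z + s • (x - z))).hasFDerivAt.comp_hasDerivAt s hl
      have h2 := (hasDerivAt_id s).mul_const (⟪G z, x - z⟫)
      have h3 := ((hasDerivAt_id s).pow 2).const_mul (β / 2 * ‖x - z‖ ^ 2)
      refine ((h1.sub h2).sub h3).congr_deriv ?_
      simp
    have hanti : AntitoneOn g (Set.Icc 0 1) := by
      refine antitoneOn_of_deriv_nonpos (convex_Icc 0 1)
        (fun s _ => (hg s).continuousAt.continuousWithinAt)
        (fun s _ => (hg s).differentiableAt.differentiableWithinAt) ?_
      intro s hs
      rw [interior_Icc] at hs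
      rw [(hg s).deriv, ← inner_sub_left]
      have h1 := real_inner_le_norm (G (z + s • (x - z)) - G z) (x - z)
      have h2 := hlip.norm_sub_le (z + s • (x - z)) z
      rw [Real.coe_toNNReal _ hβ0, add_sub_cancel_left, norm_smul, Real.norm_of_nonneg hs.1.le] at h2
      have h3 := mul_le_mul_of_nonneg_right h2 (norm_nonneg (x - z))
      nlinarith
    have h := hanti (Set.left_mem_Icc.2 zero_le_one) (Set.right_mem_Icc.2 zero_le_one) zero_le_one
    simp only [g, one_smul, zero_smul, add_zero, add_sub_cancel] at h
    linarith
  refine ⟨?_, ?_, hgrad, fun x => ⟨hhess x, hbound x⟩, fun x z => ⟨hlow x z, hup x z⟩, hlip⟩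
  · have h1 : Tendsto (fun z : EuclideanSpace ℝ (Fin d) => ‖z - y‖)
        (cocompact (EuclideanSpace ℝ (Fin d))) atTop := by
      refine tendsto_atTop_mono (fun z => norm_sub_norm_le z y) ?_
      exact tendsto_atTop_add_const_right _ _ (tendsto_norm_cocompact_atTop)
    refine tendsto_atTop_mono ?_ ((tendsto_pow_atTop two_ne_zero).comp h1)
    intro z
    simp only [F, Function.comp]
    rw [Real.le_log_iff_exp_le (by positivity)]
    linarith
  · refine ⟨convex_univ, ?_⟩
    intro x _ z _ a b ha hb hab
    set w := a • x + b • z with hw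
    have h1 := mul_nonneg ha (hlow x w)
    have h2 := mul_nonneg hb (hlow z w)
    have h3 : a * ⟪G w, x - w⟫ + b * ⟪G w, z - w⟫ = 0 := by
      rw [← real_inner_smul_right, ← real_inner_smul_right, ← inner_add_right]
      have : a • (x - w) + b • (z - w) = 0 := by
        have : a • (x - w) + b • (z - w) = w - (a + b) • w := by
          rw [hw]; module
        rw [this, hab]; simp
      rw [this, inner_zero_right]
    have h4 : F w = a * F w + b * F w := by rw [← add_mul, hab, one_mul]
    simp only [smul_eq_mul]
    linarith
end
end

section
/- Fix η > 0 and y ∈ ℝ^d. The fair loss F(x) = 2η²(‖x − y‖²/η − log(1 + ‖x − y‖²/η)) is (i) coercive: F(x) → ∞ as ‖x‖ → ∞; (ii) convex on ℝ^d; and (iii) β-smooth with β = 8η + 8·max{1, η²}: its Hessian satisfies ∇²F(x) = 4ηI − (4η²/(η + ‖x−y‖²)) I + (8η²/(‖x−y‖² + η)²)(x−y)(x−y)^⊤ and ‖∇²F(x)‖ ≤ 8η + 8·max{1, η²} for all x; consequently ∇F is Lipschitz with constant 8η + 8·max{1, η²}. -/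
noncomputable section

open scoped RealInnerProductSpace
open Filter

theorem hasFDerivAt_norm_sub_sq {d : ℕ} (x y : EuclideanSpace ℝ (Fin d)) :
    HasFDerivAt (fun z => ‖z - y‖ ^ 2) ((2 : ℝ) • innerSL ℝ (x - y)) x := by
  have h := ((hasFDerivAt_id x).sub_const y).norm_sq
  refine h.congr_fderiv ?_
  ext v
  simp [innerSL_apply_apply]

/-- for fixed `η > 0` and `y ∈ ℝ^d`, the fair loss
`F(x) = 2η²(‖x − y‖²/η − log(1 + ‖x − y‖²/η))` is (i) coercive, (ii) convex, and
(iii) `β`-smooth with `β = 8η + 8·max{1, η²}`: its gradient is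
`G(x) = 4η(1 − η/(η + ‖x−y‖²))(x − y)`, its Hessian is
`H(x) = 4ηI − (4η²/(η + ‖x−y‖²))I + (8η²/(‖x−y‖² + η)²)(x−y)(x−y)ᵀ`
with `‖H(x)‖ ≤ 8η + 8·max{1, η²}`; consequently `G` is Lipschitz with constant
`8η + 8·max{1, η²}`. -/
theorem fair_loss_properties {d : ℕ} (η : ℝ) (hη : 0 < η) (y : EuclideanSpace ℝ (Fin d)) :
    let F : EuclideanSpace ℝ (Fin d) → ℝ :=
      fun z => 2 * η ^ 2 * (‖z - y‖ ^ 2 / η - Real.log (1 + ‖z - y‖ ^ 2 / η))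
    let G : EuclideanSpace ℝ (Fin d) → EuclideanSpace ℝ (Fin d) :=
      fun z => (4 * η * (1 - η / (η + ‖z - y‖ ^ 2))) • (z - y)
    let H : EuclideanSpace ℝ (Fin d) →
        (EuclideanSpace ℝ (Fin d) →L[ℝ] EuclideanSpace ℝ (Fin d)) :=
      fun x => (4 * η) • ContinuousLinearMap.id ℝ (EuclideanSpace ℝ (Fin d)) -
        (4 * η ^ 2 / (η + ‖x - y‖ ^ 2)) •
          ContinuousLinearMap.id ℝ (EuclideanSpace ℝ (Fin d)) +
        (8 * η ^ 2 / (‖x - y‖ ^ 2 + η) ^ 2) • ((innerSL ℝ (x - y)).smulRight (x - y))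
    Tendsto F (cocompact (EuclideanSpace ℝ (Fin d))) atTop ∧
    ConvexOn ℝ Set.univ F ∧
    (∀ x, HasGradientAt F (G x) x) ∧
    (∀ x, HasFDerivAt G (H x) x ∧ ‖H x‖ ≤ 8 * η + 8 * max 1 (η ^ 2)) ∧
    (∀ x z : EuclideanSpace ℝ (Fin d),
      0 ≤ F x - F z - ⟪G z, x - z⟫ ∧
        F x - F z - ⟪G z, x - z⟫ ≤ (8 * η + 8 * max 1 (η ^ 2)) / 2 * ‖x - z‖ ^ 2) ∧
    LipschitzWith (8 * η + 8 * max 1 (η ^ 2)).toNNReal G := by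
  intro F G H
  have hgrad : ∀ x, HasGradientAt F (G x) x := by
    intro x
    rw [hasGradientAt_iff_hasFDerivAt]
    have hp : 0 < η + ‖x - y‖ ^ 2 := by positivity
    have hn := hasFDerivAt_norm_sub_sq x y
    have h1 : HasFDerivAt (fun z => ‖z - y‖ ^ 2 / η) (η⁻¹ • ((2 : ℝ) • innerSL ℝ (x - y))) x := by
      simpa [div_eq_inv_mul] using hn.const_mul η⁻¹
    have h2 := (h1.const_add 1).log (by positivity)
    have h3 := (h1.sub h2).const_mul (2 * η ^ 2)
    refine h3.congr_fderiv ?_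
    ext v
    simp [G, real_inner_smul_left, innerSL_apply_apply]
    field_simp
    ring
  have hder : ∀ x, HasFDerivAt G (H x) x := by
    intro x
    have hp : 0 < η + ‖x - y‖ ^ 2 := by positivity
    have hn := hasFDerivAt_norm_sub_sq x y
    have h1 := ((hasDerivAt_inv hp.ne').comp_hasFDerivAt x (hn.const_add η)).const_mul η
    have h2 := ((h1.const_sub 1).const_mul (4 * η)).smul ((hasFDerivAt_id x).sub_const y)
    refine h2.congr_fderiv ?_
    ext v i
    simp [H, innerSL_apply_apply]
    field_simp
    ring
  have hm : η ≤ max 1 (η ^ 2) := by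
    rcases le_total η 1 with h | h
    · exact h.trans (le_max_left _ _)
    · exact le_trans (by nlinarith) (le_max_right _ _)
  have hH : ∀ x, ‖H x‖ ≤ 8 * η + 8 * max 1 (η ^ 2) := by
    intro x
    have hp : 0 < η + ‖x - y‖ ^ 2 := by positivity
    have e : H x = (4 * η * (‖x - y‖ ^ 2 / (η + ‖x - y‖ ^ 2))) •
        ContinuousLinearMap.id ℝ (EuclideanSpace ℝ (Fin d)) +
        (8 * η ^ 2 / (‖x - y‖ ^ 2 + η) ^ 2) • ((innerSL ℝ (x - y)).smulRight (x - y)) := by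
      simp only [H]
      congr 1
      ext v i
      simp
      field_simp
      ring
    have a1 : ‖x - y‖ ^ 2 / (η + ‖x - y‖ ^ 2) ≤ 1 := by
      rw [div_le_one hp]; linarith
    have a2 : 8 * η ^ 2 / (‖x - y‖ ^ 2 + η) ^ 2 * (‖x - y‖ * ‖x - y‖) ≤ 8 * η := by
      rw [div_mul_eq_mul_div, div_le_iff₀ (by positivity)]
      nlinarith [mul_pos hη (mul_pos hη hη), mul_nonneg hη.le (sq_nonneg ‖x - y‖),
        mul_nonneg hη.le (sq_nonneg (‖x - y‖ ^ 2)), mul_nonneg (sq_nonneg η) (sq_nonneg ‖x - y‖)]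
    rw [e]
    refine (norm_add_le _ _).trans ?_
    rw [norm_smul, norm_smul, ContinuousLinearMap.norm_smulRight_apply, innerSL_apply_norm,
      Real.norm_of_nonneg (by positivity), Real.norm_of_nonneg (by positivity)]
    have a3 : 4 * η * (‖x - y‖ ^ 2 / (η + ‖x - y‖ ^ 2)) *
        ‖ContinuousLinearMap.id ℝ (EuclideanSpace ℝ (Fin d))‖ ≤ 4 * η * 1 * 1 := by
      gcongr
      exact ContinuousLinearMap.norm_id_le
    linarith
  have hkey : ∀ x z : EuclideanSpace ℝ (Fin d),
      F x - F z - ⟪G z, x - z⟫ = 2 * η * (‖x - y‖ ^ 2 - ‖z - y‖ ^ 2)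
        - 2 * η ^ 2 * Real.log ((η + ‖x - y‖ ^ 2) / (η + ‖z - y‖ ^ 2))
        - 2 * η * (1 - η / (η + ‖z - y‖ ^ 2)) *
          (‖x - y‖ ^ 2 - ‖z - y‖ ^ 2 - ‖x - z‖ ^ 2) := by
    intro x z
    have e1 : ‖x - y‖ ^ 2 = ‖z - y‖ ^ 2 + 2 * ⟪z - y, x - z⟫ + ‖x - z‖ ^ 2 := by
      rw [← norm_add_sq_real]; congr 2; abel
    have e2 : Real.log ((η + ‖x - y‖ ^ 2) / (η + ‖z - y‖ ^ 2)) =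
        Real.log (1 + ‖x - y‖ ^ 2 / η) - Real.log (1 + ‖z - y‖ ^ 2 / η) := by
      rw [← Real.log_div (by positivity) (by positivity)]
      congr 1
      field_simp
    have e3 : ⟪z - y, x - z⟫ = (‖x - y‖ ^ 2 - ‖z - y‖ ^ 2 - ‖x - z‖ ^ 2) / 2 := by linarith
    rw [e2]
    simp only [F, G, real_inner_smul_left]
    rw [e3]
    field_simp
    ring
  have hlow : ∀ x z : EuclideanSpace ℝ (Fin d), 0 ≤ F x - F z - ⟪G z, x - z⟫ := by
    intro x z
    rw [hkey]
    have hp : 0 < η + ‖x - y‖ ^ 2 := by positivity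
    have hq : 0 < η + ‖z - y‖ ^ 2 := by positivity
    have hl := Real.log_le_sub_one_of_pos (div_pos hp hq)
    have h0 : 0 ≤ 2 * η * (1 - η / (η + ‖z - y‖ ^ 2)) * ‖x - z‖ ^ 2 := by
      have : η / (η + ‖z - y‖ ^ 2) ≤ 1 := by
        rw [div_le_one hq]; nlinarith [sq_nonneg ‖z - y‖]
      have : 0 ≤ 1 - η / (η + ‖z - y‖ ^ 2) := by linarith
      positivity
    have h1 := mul_le_mul_of_nonneg_left hl (by positivity : 0 ≤ 2 * η ^ 2)
    have h2 : 2 * η ^ 2 * ((η + ‖x - y‖ ^ 2) / (η + ‖z - y‖ ^ 2) - 1) =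
        2 * η * (‖x - y‖ ^ 2 - ‖z - y‖ ^ 2)
        - 2 * η * (1 - η / (η + ‖z - y‖ ^ 2)) * (‖x - y‖ ^ 2 - ‖z - y‖ ^ 2) := by
      field_simp
      ring
    linarith
  have hup : ∀ x z : EuclideanSpace ℝ (Fin d), F x - F z - ⟪G z, x - z⟫ ≤
      (8 * η + 8 * max 1 (η ^ 2)) / 2 * ‖x - z‖ ^ 2 := by
    intro x z
    rw [hkey]
    have hp : 0 < η + ‖x - y‖ ^ 2 := by positivity
    have hq : 0 < η + ‖z - y‖ ^ 2 := by positivity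
    have hl := Real.log_le_sub_one_of_pos (div_pos hq hp)
    rw [← inv_div, Real.log_inv] at hl
    have ht : (‖x - y‖ ^ 2 - ‖z - y‖ ^ 2) ^ 2 ≤
        2 * (‖x - y‖ ^ 2 + ‖z - y‖ ^ 2) * ‖x - z‖ ^ 2 := by
      have t1 : |‖x - y‖ - ‖z - y‖| ≤ ‖x - z‖ := by
        simpa using abs_norm_sub_norm_le (x - y) (z - y)
      have t2 : (‖x - y‖ - ‖z - y‖) ^ 2 ≤ ‖x - z‖ ^ 2 := by
        rw [← sq_abs]; gcongr
      calc _ = (‖x - y‖ + ‖z - y‖) ^ 2 * (‖x - y‖ - ‖z - y‖) ^ 2 := by ring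
        _ ≤ (2 * (‖x - y‖ ^ 2 + ‖z - y‖ ^ 2)) * ‖x - z‖ ^ 2 := by
          gcongr
          nlinarith [sq_nonneg (‖x - y‖ - ‖z - y‖)]
    have h1 := mul_le_mul_of_nonneg_left hl (by positivity : 0 ≤ 2 * η ^ 2)
    rw [inv_div] at h1
    have hb : 0 ≤ ‖x - y‖ ^ 2 := by positivity
    generalize ‖x - y‖ ^ 2 = b at *
    have ha : 0 ≤ ‖z - y‖ ^ 2 := by positivity
    generalize ‖z - y‖ ^ 2 = a at *
    have hD : 0 ≤ ‖x - z‖ ^ 2 := by positivity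
    generalize ‖x - z‖ ^ 2 = D at *
    have hA : 2 * η ^ 2 * ((η + a) / (η + b) - 1) + 2 * η * (b - a) -
        2 * η * (1 - η / (η + a)) * (b - a) = 2 * η ^ 2 * ((b - a) ^ 2 / ((η + a) * (η + b))) := by
      field_simp
      ring
    have hB : 2 * η ^ 2 * ((b - a) ^ 2 / ((η + a) * (η + b))) ≤ 4 * η * D := by
      rw [← mul_div_assoc, div_le_iff₀ (by positivity)]
      have k1 := mul_le_mul_of_nonneg_left ht (by positivity : 0 ≤ 2 * η ^ 2)
      have k2 : 0 ≤ 4 * η * D * (η ^ 2 + a * b) := by positivity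
      nlinarith
    have hC : 2 * η * (1 - η / (η + a)) * D ≤ 2 * η * 1 * D := by
      gcongr
      have : 0 ≤ η / (η + a) := by positivity
      linarith
    have hE := mul_le_mul_of_nonneg_right hm hD
    have hF : 0 ≤ η * D := by positivity
    linarith
  refine ⟨?_, ?_, hgrad, fun x => ⟨hder x, hH x⟩, fun x z => ⟨hlow x z, hup x z⟩, ?_⟩
  · have hb : ∀ x, η * ‖x - y‖ ^ 2 - η ^ 2 ≤ F x := by
      intro x
      have h1 := Real.log_le_sub_one_of_pos
        (by positivity : 0 < (1 + ‖x - y‖ ^ 2 / η) / 2)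
      rw [Real.log_div (by positivity) (by norm_num)] at h1
      have h2 := Real.log_two_lt_d9
      have h3 : Real.log (1 + ‖x - y‖ ^ 2 / η) ≤ ‖x - y‖ ^ 2 / η / 2 + 1 / 2 := by linarith
      have h4 := mul_le_mul_of_nonneg_left h3 (by positivity : 0 ≤ 2 * η ^ 2)
      have h5 : 2 * η ^ 2 * (‖x - y‖ ^ 2 / η) = 2 * η * ‖x - y‖ ^ 2 := by field_simp
      simp only [F]
      nlinarith
    refine tendsto_atTop_mono hb ?_
    have t0 : Tendsto (fun x : EuclideanSpace ℝ (Fin d) => ‖x - y‖)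
        (cocompact (EuclideanSpace ℝ (Fin d))) atTop := by
      simpa [dist_eq_norm] using tendsto_dist_right_cocompact_atTop y
    have t1 := ((tendsto_pow_atTop (two_ne_zero)).comp t0).const_mul_atTop hη
    exact tendsto_atTop_add_const_right _ (-η ^ 2) t1 |>.congr fun x => by simp [sub_eq_add_neg]
  · refine ⟨convex_univ, ?_⟩
    intro x _ z _ a b ha hb hab
    have h1 := hlow x (a • x + b • z)
    have h2 := hlow z (a • x + b • z)
    have h3 : a * ⟪G (a • x + b • z), x - (a • x + b • z)⟫ +
        b * ⟪G (a • x + b • z), z - (a • x + b • z)⟫ = 0 := by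
      rw [← real_inner_smul_right, ← real_inner_smul_right, ← inner_add_right]
      have : a • (x - (a • x + b • z)) + b • (z - (a • x + b • z)) =
          (a • x + b • z) - (a + b) • (a • x + b • z) := by module
      rw [this, hab]
      simp
    have h4 := mul_nonneg ha h1
    have h5 := mul_nonneg hb h2
    have h6 : (a + b) * F (a • x + b • z) = F (a • x + b • z) := by rw [hab, one_mul]
    simp only [smul_eq_mul]
    nlinarith
  · refine lipschitzWith_of_nnnorm_fderiv_le (𝕜 := ℝ) (fun x => (hder x).differentiableAt) ?_
    intro x
    rw [(hder x).fderiv, ← NNReal.coe_le_coe, Real.coe_toNNReal _ (by positivity)]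
    exact hH x
end
end
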